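/- Let T > 0, 0 < γ̂ ≤ Γ̂ ≤ T, Δt > 0 with K = T/Δt a positive integer and γ̂/Δt, Γ̂/Δt positive integers, and η⁺, η⁻ ∈ (0,1]. Let 𝐱^b, 𝐱^r ∈ ℝ^K have nonnegative components, let 𝐝 ∈ ℝ^K, set x^b = L𝐱^b, x^r = L𝐱^r, d = L𝐝, and let p* ≥ 0, y* ∈ ℝ and an interval Ŷ₀ = [ŷ̲₀, ŷ̄₀] ⊆ ℝ be given. Then sup_{δ ∈ D̂, y₀ ∈ Ŷ₀} p*·| y(x^b,x^r,δ,y₀,T) − y* | = max_{𝛅 ∈ D̂_K, y₀ ∈ Ŷ₀} p*·| y_K(𝐱^b,𝐱^r,𝛅,y₀) − y* |. -/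

import Mathlib

open MeasureTheory Set

noncomputable section

/-- The continuous-time uncertainty set `D` of measurable frequency-deviation
scenarios `δ : [0,T] → [-1,1]` whose total absolute deviation over every
backward window of length `Γ` is at most `γ`. -/
def Dset (T Γ γ : ℝ) : Set (ℝ → ℝ) :=
  {δ | Measurable δ ∧ (∀ t ∈ Icc (0:ℝ) T, δ t ∈ Icc (-1:ℝ) 1) ∧
    ∀ t ∈ Icc (0:ℝ) T, (∫ s in (max (t - Γ) 0)..t, |δ s|) ≤ γ}

/-- The nonnegative part `D⁺` of the continuous uncertainty set. -/
def DsetPlus (T Γ γ : ℝ) : Set (ℝ → ℝ) :=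
  Dset T Γ γ ∩ {δ | ∀ t ∈ Icc (0:ℝ) T, δ t ∈ Icc (0:ℝ) 1}

/-- The discrete uncertainty set `D_K` (with `0`-based indexing): vectors in
`[-1,1]^K` whose sum of absolute values over each backward window of `W = Γ/Δt`
periods is at most `g = γ/Δt`. -/
def DK (K W g : ℕ) : Set (Fin K → ℝ) :=
  {δ | (∀ l, |δ l| ≤ 1) ∧ ∀ k : Fin K,
    (∑ l ∈ Finset.univ.filter
      (fun l : Fin K => (k : ℕ) + 1 - W ≤ (l : ℕ) ∧ (l : ℕ) ≤ (k : ℕ)), |δ l|) ≤ (g : ℝ)}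

/-- The nonnegative part `D_K⁺` of the discrete uncertainty set. -/
def DKplus (K W g : ℕ) : Set (Fin K → ℝ) :=
  DK K W g ∩ {δ | ∀ l, 0 ≤ δ l}

/-- The lifting operator `L` mapping a vector to the piecewise constant function
with value `v k` on `[kΔt, (k+1)Δt)` (0-based), and `v (K-1)` at `t = KΔt`. -/
def lift (Δt : ℝ) {K : ℕ} (v : Fin K → ℝ) : ℝ → ℝ := fun t =>
  if h : min (⌊t / Δt⌋.toNat) (K - 1) < K then v ⟨min (⌊t / Δt⌋.toNat) (K - 1), h⟩ else 0

/-- The averaging operator `L†` mapping a function to its vector of averages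
over the trading intervals. -/
def avg (Δt : ℝ) (K : ℕ) (w : ℝ → ℝ) : Fin K → ℝ := fun k =>
  (1 / Δt) * ∫ s in (((k : ℕ) : ℝ) * Δt)..((((k : ℕ) : ℝ) + 1) * Δt), w s

/-- The integrand of the continuous-time state-of-charge. -/
def socIntegrand (ηp ηm : ℝ) (xb xr δ d : ℝ → ℝ) (s : ℝ) : ℝ :=
  ηp * max (xb s + δ s * xr s) 0 - (1 / ηm) * max (-(xb s + δ s * xr s)) 0 - d s

/-- The continuous-time state-of-charge `y(x^b, x^r, δ, y₀, t)`. -/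
def soc (ηp ηm : ℝ) (xb xr δ d : ℝ → ℝ) (y0 t : ℝ) : ℝ :=
  y0 + ∫ s in (0:ℝ)..t, socIntegrand ηp ηm xb xr δ d s

/-- The discrete-time state-of-charge `y_k(𝐱^b, 𝐱^r, 𝛅, y₀)` (0-based indexing:
the sum extends over the first `k` components). -/
def ysoc (Δt ηp ηm : ℝ) {K : ℕ} (xb xr δ d : Fin K → ℝ) (y0 : ℝ) (k : ℕ) : ℝ :=
  y0 + Δt * ∑ l ∈ Finset.univ.filter (fun l : Fin K => (l : ℕ) < k),
    (ηp * max (xb l + δ l * xr l) 0 - (1 / ηm) * max (-(xb l + δ l * xr l)) 0 - d l)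

/-- The terminal state-of-charge rate of one period, as a function of the frequency deviation. -/
def socRate (ηp ηm b r d u : ℝ) : ℝ :=
  ηp * max (b + u * r) 0 - (1 / ηm) * max (-(b + u * r)) 0 - d

/-- Extension by zero of a vector to a sequence. -/
def pad {K : ℕ} (v : Fin K → ℝ) (i : ℕ) : ℝ := if h : i < K then v ⟨i, h⟩ else 0

lemma pad_apply {K : ℕ} (v : Fin K → ℝ) (l : Fin K) : pad v l = v l := by
  simp [pad]

lemma abs_pad_le_one {K : ℕ} {v : Fin K → ℝ} (hv : ∀ l, |v l| ≤ 1) (i : ℕ) : |pad v i| ≤ 1 := by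
  unfold pad
  split
  · exact hv _
  · simp

lemma integral_intFloor_add (x : ℝ) : ∫ θ in (0:ℝ)..1, (⌊x + θ⌋ : ℝ) = x := by
  have h1 : ∫ θ in (0:ℝ)..1, (⌊x + θ⌋ : ℝ) = ∫ y in x..(x + 1), (⌊y⌋ : ℝ) := by
    have := intervalIntegral.integral_comp_add_left (a := 0) (b := 1) (fun y : ℝ => (⌊y⌋ : ℝ)) x
    simpa using this
  have hfl : ∀ a b : ℝ, IntervalIntegrable (fun y : ℝ => (⌊y⌋ : ℝ)) volume a b := fun a b =>
    Monotone.intervalIntegrable fun y z h => by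
      exact_mod_cast Int.floor_mono h
  have hid : ∀ a b : ℝ, IntervalIntegrable (fun y : ℝ => y) volume a b := fun a b =>
    continuous_id.intervalIntegrable a b
  have h2 : ∀ a : ℝ, ∫ y in a..(a + 1), (⌊y⌋ : ℝ)
      = (∫ y in a..(a + 1), y) - ∫ y in a..(a + 1), Int.fract y := by
    intro a
    rw [← intervalIntegral.integral_sub (hid _ _)]
    · exact intervalIntegral.integral_congr fun y _ => by
        have := Int.floor_add_fract y
        linarith
    · have := (hid a (a + 1)).sub (hfl a (a + 1))
      exact this
  have h3 : ∫ y in x..(x + 1), Int.fract y = ∫ y in (0:ℝ)..(0 + 1), Int.fract y :=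
    (Int.fract_periodic ℝ).intervalIntegral_add_eq x 0
  have h4 : ∫ y in (0:ℝ)..(0 + 1), Int.fract y = 1 / 2 := by
    rw [intervalIntegral.integral_congr_Ioo_of_le (g := fun y => y) (by norm_num)]
    · rw [integral_id]; norm_num
    · intro y hy
      exact Int.fract_eq_self.2 ⟨hy.1.le, by simpa using hy.2⟩
  rw [h1, h2, h3, h4, integral_id]
  ring

/-- Integrality of the polytope of window constraints: a linear functional at a fractional point
is dominated by its value at some `0`-`1` point satisfying the same integral window bounds. -/
lemma exists_zero_one_rounding (K : ℕ) (a c : ℕ → ℝ) (ha0 : ∀ i < K, 0 ≤ a i)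
    (ha1 : ∀ i < K, a i ≤ 1) :
    ∃ b : ℕ → ℝ, (∀ i < K, b i = 0 ∨ b i = 1) ∧
      (∀ m n g : ℕ, m ≤ n → n ≤ K → ∑ i ∈ Finset.Ico m n, a i ≤ g →
        ∑ i ∈ Finset.Ico m n, b i ≤ g) ∧
      ∑ i ∈ Finset.range K, c i * a i ≤ ∑ i ∈ Finset.range K, c i * b i := by
  set S : ℕ → ℝ := fun n => ∑ i ∈ Finset.range n, a i with hS
  have hSsucc : ∀ i, S (i + 1) = S i + a i := fun i => Finset.sum_range_succ _ _
  set z : ℝ → ℕ → ℝ := fun θ n => (⌊S n + θ⌋ : ℝ) with hz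
  have hzint : ∀ n, IntervalIntegrable (fun θ => z θ n) volume 0 1 := fun n =>
    Monotone.intervalIntegrable fun y w h => by
      have : S n + y ≤ S n + w := by linarith
      exact Int.cast_le.2 (Int.floor_mono this)
  have hterm : ∀ i, IntervalIntegrable (fun θ => c i * (z θ (i + 1) - z θ i)) volume 0 1 :=
    fun i => ((hzint (i + 1)).sub (hzint i)).const_mul _
  obtain ⟨θ, hθ⟩ : ∃ θ, ∑ i ∈ Finset.range K, c i * a i
      ≤ ∑ i ∈ Finset.range K, c i * (z θ (i + 1) - z θ i) := by
    by_contra! hcon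
    have hsum : IntervalIntegrable
        (fun θ => ∑ i ∈ Finset.range K, c i * (z θ (i + 1) - z θ i)) volume 0 1 := by
      have := IntervalIntegrable.sum (Finset.range K) (μ := volume) (a := 0) (b := 1)
        (f := fun i θ => c i * (z θ (i + 1) - z θ i)) fun i _ => hterm i
      have hfun : (∑ i ∈ Finset.range K, fun θ => c i * (z θ (i + 1) - z θ i))
          = fun θ => ∑ i ∈ Finset.range K, c i * (z θ (i + 1) - z θ i) := by
        funext θ
        simp
      rwa [hfun] at this
    have hpos := intervalIntegral.intervalIntegral_pos_of_pos
      ((intervalIntegrable_const (c := ∑ i ∈ Finset.range K, c i * a i)).sub hsum)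
      (fun θ => sub_pos.2 (hcon θ)) one_pos
    rw [intervalIntegral.integral_sub intervalIntegrable_const hsum,
      intervalIntegral.integral_finsetSum fun i _ => hterm i] at hpos
    have heq : ∀ i, ∫ θ in (0:ℝ)..1, c i * (z θ (i + 1) - z θ i) = c i * a i := by
      intro i
      rw [intervalIntegral.integral_const_mul, intervalIntegral.integral_sub (hzint _) (hzint _)]
      simp only [hz]
      rw [integral_intFloor_add, integral_intFloor_add, hSsucc]
      ring
    simp [heq] at hpos
  refine ⟨fun i => z θ (i + 1) - z θ i, fun i hi => ?_, fun m n g hmn hn hg => ?_, hθ⟩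
  · have h0 := ha0 i hi
    have h1 := ha1 i hi
    have hlo : ⌊S i + θ⌋ ≤ ⌊S (i + 1) + θ⌋ := Int.floor_mono (by rw [hSsucc]; linarith)
    have hup : ⌊S (i + 1) + θ⌋ ≤ ⌊S i + θ⌋ + 1 := by
      rw [← Int.floor_add_one]
      exact Int.floor_mono (by rw [hSsucc]; linarith)
    obtain h | h : ⌊S (i + 1) + θ⌋ = ⌊S i + θ⌋ ∨ ⌊S (i + 1) + θ⌋ = ⌊S i + θ⌋ + 1 := by omega
    · left; simp [hz, h]
    · right; simp [hz, h]
  · rw [Finset.sum_Ico_eq_sub _ hmn] at hg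
    rw [Finset.sum_Ico_eq_sub _ hmn, Finset.sum_range_sub, Finset.sum_range_sub]
    have : ⌊S n + θ⌋ ≤ ⌊S m + θ⌋ + (g : ℤ) := by
      rw [← Int.floor_add_natCast]
      exact Int.floor_mono (by simp only [hS]; linarith)
    have h' : (⌊S n + θ⌋ : ℝ) ≤ ⌊S m + θ⌋ + g := by exact_mod_cast this
    simp only [hz]
    linarith

lemma exists_socRate_supergradient {ηp ηm b r d : ℝ} (hηp : ηp ∈ Ioc (0:ℝ) 1)
    (hηm : ηm ∈ Ioc (0:ℝ) 1) (m : ℝ) :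
    ∃ c, ∀ u, socRate ηp ηm b r d u ≤ socRate ηp ηm b r d m + c * (u - m) := by
  have hκ : 1 ≤ 1 / ηm := by rw [le_div_iff₀ hηm.1]; linarith [hηm.2]
  have hp := hηp.2
  unfold socRate
  generalize 1 / ηm = κ at hκ
  rcases le_total 0 (b + m * r) with hm | hm
  · refine ⟨ηp * r, fun u => ?_⟩
    rw [max_eq_left hm, max_eq_right (neg_nonpos.2 hm)]
    rcases le_total 0 (b + u * r) with hu | hu
    · rw [max_eq_left hu, max_eq_right (neg_nonpos.2 hu)]; linarith
    · rw [max_eq_right hu, max_eq_left (neg_nonneg.2 hu)]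
      nlinarith [mul_nonneg (sub_nonneg.2 (hp.trans hκ)) (neg_nonneg.2 hu)]
  · refine ⟨κ * r, fun u => ?_⟩
    rw [max_eq_right hm, max_eq_left (neg_nonneg.2 hm)]
    rcases le_total 0 (b + u * r) with hu | hu
    · rw [max_eq_left hu, max_eq_right (neg_nonpos.2 hu)]
      nlinarith [mul_nonneg (sub_nonneg.2 (hp.trans hκ)) hu]
    · rw [max_eq_right hu, max_eq_left (neg_nonneg.2 hu)]; linarith

lemma socRate_chord_le {ηp ηm b r d u : ℝ} (hηp : ηp ∈ Ioc (0:ℝ) 1)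
    (hηm : ηm ∈ Ioc (0:ℝ) 1) (hb : 0 ≤ b) (hr : 0 ≤ r) (hu : |u| ≤ 1) :
    socRate ηp ηm b r d 0 - (socRate ηp ηm b r d 0 - socRate ηp ηm b r d (-1)) * |u|
      ≤ socRate ηp ηm b r d u := by
  have hκ : 1 ≤ 1 / ηm := by rw [le_div_iff₀ hηm.1]; linarith [hηm.2]
  have hp := hηp.2
  have hp0 := hηp.1
  unfold socRate
  generalize 1 / ηm = κ at hκ
  have hκp : 0 ≤ κ - ηp := by linarith
  have hur : 0 ≤ (u + |u|) * r := mul_nonneg (by linarith [neg_abs_le u]) hr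
  have h0 := abs_nonneg u
  generalize |u| = w at *
  simp only [zero_mul, add_zero]
  rw [max_eq_left hb, max_eq_right (neg_nonpos.2 hb)]
  rcases le_total 0 (b + -1 * r) with h1 | h1
  · have hz : 0 ≤ b + u * r := by nlinarith
    rw [max_eq_left h1, max_eq_right (neg_nonpos.2 h1), max_eq_left hz,
      max_eq_right (neg_nonpos.2 hz)]
    nlinarith [mul_nonneg hp0.le hur]
  · rw [max_eq_right h1, max_eq_left (neg_nonneg.2 h1)]
    rcases le_total 0 (b + u * r) with hz | hz
    · rw [max_eq_left hz, max_eq_right (neg_nonpos.2 hz)]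
      nlinarith [mul_nonneg hp0.le hur, mul_nonneg (mul_nonneg hκp h0) (neg_nonneg.2 h1)]
    · rw [max_eq_right hz, max_eq_left (neg_nonneg.2 hz)]
      nlinarith [mul_nonneg (by linarith : 0 ≤ κ) hur,
        mul_nonneg (mul_nonneg hκp (sub_nonneg.2 hu)) hb]

lemma intervalIntegrable_of_abs_le {f : ℝ → ℝ} (hf : Measurable f) {a b C : ℝ} (hab : a ≤ b)
    (hC : ∀ x ∈ Icc a b, |f x| ≤ C) : IntervalIntegrable f volume a b := by
  rw [intervalIntegrable_iff_integrableOn_Icc_of_le hab]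
  refine Measure.integrableOn_of_bounded (M := C) (by simp) hf.aestronglyMeasurable ?_
  filter_upwards [ae_restrict_mem measurableSet_Icc] with x hx using hC x hx

lemma lift_eq_pad {Δt : ℝ} (hΔt : 0 < Δt) {K : ℕ} (v : Fin K → ℝ) {i : ℕ} (hi : i < K) {s : ℝ}
    (hs : s ∈ Ico ((i : ℝ) * Δt) (((i + 1 : ℕ) : ℝ) * Δt)) : lift Δt v s = pad v i := by
  have h : ⌊s / Δt⌋ = (i : ℤ) := by
    rw [Int.floor_eq_iff, le_div_iff₀ hΔt, div_lt_iff₀ hΔt]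
    have h2 := hs.2
    push_cast at h2 ⊢
    exact ⟨hs.1, h2⟩
  have h2 : min (⌊s / Δt⌋.toNat) (K - 1) = i := by rw [h]; simp; omega
  simp only [lift, h2, pad]

lemma measurable_lift (Δt : ℝ) {K : ℕ} (v : Fin K → ℝ) : Measurable (lift Δt v) := by
  have h : Measurable fun m : ℤ =>
      if h : min m.toNat (K - 1) < K then v ⟨min m.toNat (K - 1), h⟩ else 0 := measurable_from_top
  exact h.comp (Int.measurable_floor.comp (measurable_id.div_const Δt))

lemma abs_lift_le_one (Δt : ℝ) {K : ℕ} {v : Fin K → ℝ} (hv : ∀ l, |v l| ≤ 1) (s : ℝ) :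
    |lift Δt v s| ≤ 1 := by
  unfold lift
  split
  · exact hv _
  · simp

lemma continuous_socRate (ηp ηm b r d : ℝ) : Continuous (socRate ηp ηm b r d) := by
  unfold socRate
  fun_prop

lemma cell_subset {Δt : ℝ} (hΔt : 0 < Δt) {K i : ℕ} (hi : i < K) :
    Icc ((i : ℝ) * Δt) (((i + 1 : ℕ) : ℝ) * Δt) ⊆ Icc 0 (K * Δt) := by
  refine Icc_subset_Icc (by positivity) ?_
  have : ((i + 1 : ℕ) : ℝ) ≤ K := by exact_mod_cast hi
  gcongr

lemma cell_le {Δt : ℝ} (hΔt : 0 < Δt) (i : ℕ) :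
    (i : ℝ) * Δt ≤ ((i + 1 : ℕ) : ℝ) * Δt := by
  push_cast
  gcongr
  linarith

lemma intervalIntegrable_socRate_comp {Δt : ℝ} (hΔt : 0 < Δt) {K i : ℕ} (hi : i < K)
    {δ : ℝ → ℝ} (hδ : Measurable δ) (hδ1 : ∀ t ∈ Icc (0:ℝ) (K * Δt), δ t ∈ Icc (-1:ℝ) 1)
    (ηp ηm b r d : ℝ) :
    IntervalIntegrable (fun s => socRate ηp ηm b r d (δ s)) volume
      ((i : ℝ) * Δt) (((i + 1 : ℕ) : ℝ) * Δt) := by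
  obtain ⟨C, hC⟩ := (isCompact_Icc (a := (-1:ℝ)) (b := 1)).exists_bound_of_continuousOn
    (continuous_socRate ηp ηm b r d).continuousOn
  exact intervalIntegrable_of_abs_le ((continuous_socRate ηp ηm b r d).measurable.comp hδ)
    (cell_le hΔt i) fun x hx => hC _ (hδ1 x (cell_subset hΔt hi hx))

lemma soc_eq_sum {Δt : ℝ} (hΔt : 0 < Δt) {K : ℕ} {δ : ℝ → ℝ} (hδ : Measurable δ)
    (hδ1 : ∀ t ∈ Icc (0:ℝ) (K * Δt), δ t ∈ Icc (-1:ℝ) 1) (ηp ηm : ℝ) (xb xr d : Fin K → ℝ)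
    (y0 : ℝ) :
    soc ηp ηm (lift Δt xb) (lift Δt xr) δ (lift Δt d) y0 (K * Δt) =
      y0 + ∑ i ∈ Finset.range K, ∫ s in ((i : ℝ) * Δt)..(((i + 1 : ℕ) : ℝ) * Δt),
        socRate ηp ηm (pad xb i) (pad xr i) (pad d i) (δ s) := by
  have heq : ∀ i < K, EqOn (fun s => socRate ηp ηm (pad xb i) (pad xr i) (pad d i) (δ s))
      (socIntegrand ηp ηm (lift Δt xb) (lift Δt xr) δ (lift Δt d))
      (Ioo ((i : ℝ) * Δt) (((i + 1 : ℕ) : ℝ) * Δt)) := by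
    intro i hi s hs
    have hs' := Ioo_subset_Ico_self hs
    simp only [socRate, socIntegrand, lift_eq_pad hΔt _ hi hs']
  unfold soc
  have h := intervalIntegral.sum_integral_adjacent_intervals (μ := volume) (n := K)
    (a := fun i : ℕ => (i : ℝ) * Δt)
    (f := socIntegrand ηp ηm (lift Δt xb) (lift Δt xr) δ (lift Δt d)) fun i hi =>
      (intervalIntegrable_socRate_comp hΔt hi hδ hδ1 ηp ηm (pad xb i) (pad xr i)
        (pad d i)).congr_uIoo (by rw [uIoo_of_le (cell_le hΔt i)]; exact heq i hi)
  simp only [Nat.cast_zero, zero_mul] at h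
  rw [← h]
  congr 1
  refine Finset.sum_congr rfl fun i hi => ?_
  exact (intervalIntegral.integral_congr_Ioo_of_le (cell_le hΔt i)
    (heq i (Finset.mem_range.1 hi))).symm

lemma ysoc_eq_sum (Δt ηp ηm : ℝ) {K : ℕ} (xb xr δ d : Fin K → ℝ) (y0 : ℝ) :
    ysoc Δt ηp ηm xb xr δ d y0 K = y0 + ∑ i ∈ Finset.range K,
      Δt * socRate ηp ηm (pad xb i) (pad xr i) (pad d i) (pad δ i) := by
  unfold ysoc
  rw [← Fin.sum_univ_eq_sum_range
    (fun i => Δt * socRate ηp ηm (pad xb i) (pad xr i) (pad d i) (pad δ i)), ← Finset.mul_sum]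
  simp [pad_apply, socRate]

lemma window_sum_eq {K : ℕ} (f : ℕ → ℝ) (W : ℕ) (k : Fin K) :
    ∑ l ∈ Finset.univ.filter
      (fun l : Fin K => (k : ℕ) + 1 - W ≤ (l : ℕ) ∧ (l : ℕ) ≤ (k : ℕ)), f l
      = ∑ i ∈ Finset.Ico ((k : ℕ) + 1 - W) ((k : ℕ) + 1), f i := by
  rw [Finset.sum_filter, Fin.sum_univ_eq_sum_range
    (fun i => if (k : ℕ) + 1 - W ≤ i ∧ i ≤ (k : ℕ) then f i else 0), ← Finset.sum_filter]
  refine Finset.sum_congr ?_ fun _ _ => rfl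
  ext i
  have := k.2
  simp only [Finset.mem_filter, Finset.mem_range, Finset.mem_Ico]
  omega

lemma mem_DK_iff {K W g : ℕ} {v : Fin K → ℝ} :
    v ∈ DK K W g ↔ (∀ l, |v l| ≤ 1) ∧
      ∀ k < K, ∑ i ∈ Finset.Ico (k + 1 - W) (k + 1), |pad v i| ≤ g := by
  unfold DK
  simp only [mem_ofPred_eq]
  refine and_congr_right fun _ => ?_
  have : ∀ k : Fin K, (∑ l ∈ Finset.univ.filter
      (fun l : Fin K => (k : ℕ) + 1 - W ≤ (l : ℕ) ∧ (l : ℕ) ≤ (k : ℕ)), |v l|)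
      = ∑ i ∈ Finset.Ico ((k : ℕ) + 1 - W) ((k : ℕ) + 1), |pad v i| := by
    intro k
    rw [← window_sum_eq (fun i => |pad v i|)]
    simp only [pad_apply]
  simp only [this]
  exact ⟨fun h k hk => h ⟨k, hk⟩, fun h k => h k k.2⟩

lemma mem_DK_of_abs_le {K W g : ℕ} {v : Fin K → ℝ} (a : ℕ → ℝ) (ha : ∀ i < K, a i ≤ 1)
    (hg : ∀ k < K, ∑ i ∈ Finset.Ico (k + 1 - W) (k + 1), a i ≤ g)
    (hv : ∀ l : Fin K, |v l| ≤ a l) : v ∈ DK K W g := by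
  rw [mem_DK_iff]
  refine ⟨fun l => (hv l).trans (ha l l.2), fun k hk => le_trans ?_ (hg k hk)⟩
  refine Finset.sum_le_sum fun i hi => ?_
  have hi' : i < K := by have := (Finset.mem_Ico.1 hi).2; omega
  have := hv ⟨i, hi'⟩
  simpa [pad, hi'] using this

/-- Averages of the absolute value over the trading periods inherit the window bounds. -/
lemma avg_abs_window_le {Δt : ℝ} (hΔt : 0 < Δt) {K W g : ℕ} {δ : ℝ → ℝ}
    (hδ : δ ∈ Dset (K * Δt) (W * Δt) (g * Δt)) {k : ℕ} (hk : k < K) :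
    ∑ i ∈ Finset.Ico (k + 1 - W) (k + 1),
      (1 / Δt) * ∫ s in ((i : ℝ) * Δt)..(((i + 1 : ℕ) : ℝ) * Δt), |δ s| ≤ g := by
  obtain ⟨hm, h1, hw⟩ := hδ
  rw [← Finset.mul_sum, intervalIntegral.sum_integral_adjacent_intervals_Ico
    (a := fun i : ℕ => (i : ℝ) * Δt) (by omega)]
  · have hmem : ((k + 1 : ℕ) : ℝ) * Δt ∈ Icc (0:ℝ) (K * Δt) :=
      cell_subset hΔt hk (right_mem_Icc.2 (cell_le hΔt k))
    have h := hw _ hmem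
    have hmax : max (((k + 1 : ℕ) : ℝ) * Δt - W * Δt) 0 = ((k + 1 - W : ℕ) : ℝ) * Δt := by
      rcases le_total W (k + 1) with hle | hle
      · rw [Nat.cast_sub hle, sub_mul, max_eq_left]
        rw [← sub_mul]
        exact mul_nonneg (sub_nonneg.2 (by exact_mod_cast hle)) hΔt.le
      · rw [Nat.sub_eq_zero_of_le hle, max_eq_right]
        · simp
        · rw [← sub_mul]
          exact mul_nonpos_of_nonpos_of_nonneg (sub_nonpos.2 (by exact_mod_cast hle)) hΔt.le
    rw [hmax] at h
    rw [one_div, inv_mul_le_iff₀ hΔt, mul_comm Δt]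
    exact h
  · intro i hi
    exact intervalIntegrable_of_abs_le (C := 1) hm.abs (cell_le hΔt i) fun x hx => by
      rw [abs_abs]
      exact abs_le.2 (h1 x (cell_subset hΔt (by have := hi.2; omega) hx))

lemma sum_window_int (f : ℕ → ℝ) (n : ℕ) (W : ℕ) :
    ∑ j ∈ Finset.range W, (if 0 ≤ (n : ℤ) - j then f ((n : ℤ) - j).toNat else 0)
      = ∑ i ∈ Finset.Ico (n + 1 - W) (n + 1), f i := by
  induction W with
  | zero => simp
  | succ W ih =>
    rw [Finset.sum_range_succ, ih]
    rcases le_or_gt W n with h | h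
    · have h0 : 0 ≤ (n : ℤ) - W := by omega
      rw [if_pos h0, show n + 1 - (W + 1) = n - W by omega,
        show n + 1 - W = n - W + 1 by omega,
        Finset.sum_eq_sum_Ico_succ_bot (show n - W < n + 1 by omega),
        show ((n : ℤ) - W).toNat = n - W by omega, add_comm]
    · have h0 : ¬ 0 ≤ (n : ℤ) - W := by omega
      rw [if_neg h0, show n + 1 - (W + 1) = n + 1 - W by omega, add_zero]

lemma lift_mem_Dset {Δt : ℝ} (hΔt : 0 < Δt) {K W g : ℕ} {v : Fin K → ℝ} (hv : v ∈ DK K W g) :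
    lift Δt v ∈ Dset (K * Δt) (W * Δt) (g * Δt) := by
  rw [mem_DK_iff] at hv
  obtain ⟨hv1, hvw⟩ := hv
  refine ⟨measurable_lift _ _, fun t _ => abs_le.1 (abs_lift_le_one Δt hv1 t), fun t ht => ?_⟩
  set f : ℤ → ℝ := fun m => if 0 ≤ m then |pad v m.toNat| else 0 with hf
  have hf0 : ∀ m, 0 ≤ f m := fun m => by
    simp only [hf]; split <;> positivity
  have hf1 : ∀ m, f m ≤ 1 := fun m => by
    simp only [hf]
    split
    · exact abs_pad_le_one hv1 _
    · exact zero_le_one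
  set H : ℝ → ℝ := fun s => f ⌊s / Δt⌋ with hH
  have hHm : Measurable H :=
    (measurable_from_top (f := f)).comp (Int.measurable_floor.comp (measurable_id.div_const Δt))
  have hHi : ∀ a b, a ≤ b → IntervalIntegrable H volume a b := fun a b hab =>
    intervalIntegrable_of_abs_le (C := 1) hHm hab fun x _ => by
      rw [abs_of_nonneg (hf0 _)]; exact hf1 _
  have hHeq : ∀ s, 0 ≤ s → s < K * Δt → |lift Δt v s| = H s := by
    intro s h0 hsK
    have hm0 : 0 ≤ ⌊s / Δt⌋ := Int.floor_nonneg.2 (by positivity)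
    obtain ⟨n, hn⟩ := Int.eq_ofNat_of_zero_le hm0
    have hn' := hn
    rw [Int.floor_eq_iff, le_div_iff₀ hΔt, div_lt_iff₀ hΔt] at hn'
    push_cast at hn'
    have hnK : n < K := by
      have : (n : ℝ) * Δt < K * Δt := hn'.1.trans_lt hsK
      exact_mod_cast lt_of_mul_lt_mul_right this hΔt.le
    rw [lift_eq_pad hΔt v hnK ⟨hn'.1, by push_cast; exact hn'.2⟩]
    simp [hH, hf, hn]
  have hW0 : 0 ≤ (W : ℝ) * Δt := by positivity
  calc ∫ s in (max (t - W * Δt) 0)..t, |lift Δt v s|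
      = ∫ s in (max (t - W * Δt) 0)..t, H s := by
        refine intervalIntegral.integral_congr_Ioo_of_le (max_le (by linarith) ht.1) fun s hs => ?_
        exact hHeq s ((le_max_right _ _).trans hs.1.le) (hs.2.trans_le ht.2)
    _ ≤ ∫ s in (t - W * Δt)..t, H s :=
        intervalIntegral.integral_mono_interval (le_max_left _ _) (max_le (by linarith) ht.1) le_rfl
          (Filter.Eventually.of_forall fun s => hf0 _) (hHi _ _ (by linarith))
    _ = ∑ j ∈ Finset.range W, ∫ s in (t - Δt)..t, H (s - j * Δt) := by
        have hadj := intervalIntegral.sum_integral_adjacent_intervals (μ := volume) (n := W)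
          (a := fun j : ℕ => t - j * Δt) (f := H) fun j _ =>
            (hHi _ _ (by have := cell_le hΔt j; linarith)).symm
        simp only [Nat.cast_zero, zero_mul, sub_zero] at hadj
        rw [intervalIntegral.integral_symm, ← hadj, ← Finset.sum_neg_distrib]
        refine Finset.sum_congr rfl fun j _ => ?_
        rw [← intervalIntegral.integral_symm, intervalIntegral.integral_comp_sub_right]
        congr 1
        push_cast; ring
    _ = ∫ s in (t - Δt)..t, ∑ j ∈ Finset.range W, H (s - j * Δt) := by
        rw [intervalIntegral.integral_finsetSum fun j _ => ?_]
        exact intervalIntegrable_of_abs_le (C := 1) (hHm.comp (measurable_id.sub_const _))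
          (by linarith) fun x _ => (abs_of_nonneg (hf0 _)).trans_le (hf1 _)
    _ ≤ ∫ _ in (t - Δt)..t, (g : ℝ) := by
        refine intervalIntegral.integral_mono_on_of_le_Ioo (by linarith) ?_ (by simp) ?_
        · refine intervalIntegrable_of_abs_le (C := W) (Finset.measurable_sum _ fun j _ =>
            hHm.comp (measurable_id.sub_const _)) (by linarith) fun x _ => ?_
          refine (abs_of_nonneg (Finset.sum_nonneg fun j _ => hf0 _)).trans_le ?_
          calc _ ≤ ∑ j ∈ Finset.range W, (1 : ℝ) := Finset.sum_le_sum fun j _ => hf1 _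
            _ = W := by simp
        · intro s hs
          have hsub : ∀ j : ℕ, H (s - j * Δt) = f (⌊s / Δt⌋ - j) := by
            intro j
            simp only [hH]
            rw [sub_div, mul_div_cancel_right₀ _ hΔt.ne', Int.floor_sub_natCast]
          simp only [hsub]
          rcases lt_or_ge ⌊s / Δt⌋ 0 with hneg | hpos
          · rw [Finset.sum_eq_zero]
            · positivity
            · intro j _
              simp only [hf]
              rw [if_neg (by omega)]
          · obtain ⟨n, hn⟩ := Int.eq_ofNat_of_zero_le hpos
            have hnK : n < K := by
              have h1 : (n : ℝ) ≤ s / Δt := by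
                have := Int.floor_le (s / Δt)
                rw [hn] at this
                exact_mod_cast this
              rw [le_div_iff₀ hΔt] at h1
              have : (n : ℝ) * Δt < K * Δt := h1.trans_lt (hs.2.trans_le ht.2)
              exact_mod_cast lt_of_mul_lt_mul_right this hΔt.le
            rw [hn]
            exact (sum_window_int (fun i => |pad v i|) n W).trans_le (hvw n hnK)
    _ = g * Δt := by simp; ring

lemma soc_lift_eq_ysoc {Δt : ℝ} (hΔt : 0 < Δt) {K : ℕ} {v : Fin K → ℝ} (hv : ∀ l, |v l| ≤ 1)
    (ηp ηm : ℝ) (xb xr d : Fin K → ℝ) (y0 : ℝ) :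
    soc ηp ηm (lift Δt xb) (lift Δt xr) (lift Δt v) (lift Δt d) y0 (K * Δt) =
      ysoc Δt ηp ηm xb xr v d y0 K := by
  rw [soc_eq_sum hΔt (measurable_lift _ _) (fun t _ => abs_le.1 (abs_lift_le_one Δt hv t)),
    ysoc_eq_sum]
  congr 1
  refine Finset.sum_congr rfl fun i hi => ?_
  rw [intervalIntegral.integral_congr_Ioo_of_le
    (g := fun _ => socRate ηp ηm (pad xb i) (pad xr i) (pad d i) (pad v i)) (cell_le hΔt i)]
  · simp; left; ring
  · intro s hs
    simp only [lift_eq_pad hΔt v (Finset.mem_range.1 hi) (Ioo_subset_Ico_self hs)]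

lemma exists_soc_le_ysoc {Δt : ℝ} (hΔt : 0 < Δt) {K W g : ℕ} {δ : ℝ → ℝ}
    (hδ : δ ∈ Dset (K * Δt) (W * Δt) (g * Δt)) {ηp ηm : ℝ} (hηp : ηp ∈ Ioc (0:ℝ) 1)
    (hηm : ηm ∈ Ioc (0:ℝ) 1) (xb xr d : Fin K → ℝ) (y0 : ℝ) :
    ∃ v ∈ DK K W g, soc ηp ηm (lift Δt xb) (lift Δt xr) δ (lift Δt d) y0 (K * Δt) ≤
      ysoc Δt ηp ηm xb xr v d y0 K := by
  have hwin := fun k (hk : k < K) => avg_abs_window_le hΔt hδ hk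
  obtain ⟨hm, h1, -⟩ := hδ
  have hab : ∀ i < K, ∀ x ∈ Icc ((i : ℝ) * Δt) (((i + 1 : ℕ) : ℝ) * Δt), |δ x| ≤ 1 :=
    fun i hi x hx => abs_le.2 (h1 x (cell_subset hΔt hi hx))
  have hint : ∀ i < K, IntervalIntegrable δ volume ((i : ℝ) * Δt) (((i + 1 : ℕ) : ℝ) * Δt) :=
    fun i hi => intervalIntegrable_of_abs_le hm (cell_le hΔt i) (hab i hi)
  refine ⟨avg Δt K δ, mem_DK_of_abs_le _ (fun i hi => ?_) hwin fun l => ?_, ?_⟩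
  · rw [one_div, inv_mul_le_iff₀ hΔt]
    calc _ ≤ ∫ _ in ((i : ℝ) * Δt)..(((i + 1 : ℕ) : ℝ) * Δt), (1 : ℝ) :=
          intervalIntegral.integral_mono_on (cell_le hΔt i) (hint i hi).abs (by simp) (hab i hi)
      _ = Δt * 1 := by simp; ring
  · unfold avg
    rw [abs_mul, abs_of_nonneg (by positivity : 0 ≤ 1 / Δt)]
    have := intervalIntegral.abs_integral_le_integral_abs (f := δ) (μ := volume)
      (cell_le hΔt l)
    push_cast at this ⊢
    gcongr
  · rw [soc_eq_sum hΔt hm h1, ysoc_eq_sum]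
    gcongr with i hi
    rw [Finset.mem_range] at hi
    obtain ⟨c, hc⟩ := exists_socRate_supergradient (b := pad xb i) (r := pad xr i) (d := pad d i)
      hηp hηm (pad (avg Δt K δ) i)
    have hI : ∫ s in ((i : ℝ) * Δt)..(((i + 1 : ℕ) : ℝ) * Δt), δ s
        = Δt * pad (avg Δt K δ) i := by
      simp only [pad, hi, avg, dif_pos]
      push_cast
      field_simp
    have hlin := ((hint i hi).sub
      (intervalIntegrable_const (c := pad (avg Δt K δ) i))).const_mul c
    refine (intervalIntegral.integral_mono_on (cell_le hΔt i)
      (intervalIntegrable_socRate_comp hΔt hi hm h1 _ _ _ _ _)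
      (intervalIntegrable_const.add hlin) fun s _ => hc (δ s)).trans_eq ?_
    rw [intervalIntegral.integral_add intervalIntegrable_const hlin,
      intervalIntegral.integral_const_mul,
      intervalIntegral.integral_sub (hint i hi) intervalIntegrable_const, hI]
    simp only [intervalIntegral.integral_const, smul_eq_mul]
    push_cast
    ring

lemma exists_ysoc_le_soc {Δt : ℝ} (hΔt : 0 < Δt) {K W g : ℕ} {δ : ℝ → ℝ}
    (hδ : δ ∈ Dset (K * Δt) (W * Δt) (g * Δt)) {ηp ηm : ℝ} (hηp : ηp ∈ Ioc (0:ℝ) 1)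
    (hηm : ηm ∈ Ioc (0:ℝ) 1) {xb xr : Fin K → ℝ} (hxb : ∀ l, 0 ≤ xb l) (hxr : ∀ l, 0 ≤ xr l)
    (d : Fin K → ℝ) (y0 : ℝ) :
    ∃ v ∈ DK K W g, ysoc Δt ηp ηm xb xr v d y0 K ≤
      soc ηp ηm (lift Δt xb) (lift Δt xr) δ (lift Δt d) y0 (K * Δt) := by
  have hwin := fun k (hk : k < K) => avg_abs_window_le hΔt hδ hk
  obtain ⟨hm, h1, -⟩ := hδ
  have hab : ∀ i < K, ∀ x ∈ Icc ((i : ℝ) * Δt) (((i + 1 : ℕ) : ℝ) * Δt), |δ x| ≤ 1 :=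
    fun i hi x hx => abs_le.2 (h1 x (cell_subset hΔt hi hx))
  have hint : ∀ i < K, IntervalIntegrable (fun s => |δ s|) volume
      ((i : ℝ) * Δt) (((i + 1 : ℕ) : ℝ) * Δt) :=
    fun i hi => (intervalIntegrable_of_abs_le hm (cell_le hΔt i) (hab i hi)).abs
  set a : ℕ → ℝ := fun i =>
    (1 / Δt) * ∫ s in ((i : ℝ) * Δt)..(((i + 1 : ℕ) : ℝ) * Δt), |δ s| with ha
  have ha1 : ∀ i < K, a i ≤ 1 := by
    intro i hi
    simp only [ha]
    rw [one_div, inv_mul_le_iff₀ hΔt]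
    calc _ ≤ ∫ _ in ((i : ℝ) * Δt)..(((i + 1 : ℕ) : ℝ) * Δt), (1 : ℝ) :=
          intervalIntegral.integral_mono_on (cell_le hΔt i) (hint i hi) (by simp) (hab i hi)
      _ = Δt * 1 := by simp; ring
  have ha0 : ∀ i < K, 0 ≤ a i := fun i _ => mul_nonneg (by positivity)
    (intervalIntegral.integral_nonneg (cell_le hΔt i) fun s _ => abs_nonneg _)
  set φ : ℕ → ℝ → ℝ := fun i => socRate ηp ηm (pad xb i) (pad xr i) (pad d i) with hφ
  obtain ⟨b, hb01, hbw, hbc⟩ :=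
    exists_zero_one_rounding K a (fun i => φ i 0 - φ i (-1)) ha0 ha1
  have hb_nonneg : ∀ i < K, 0 ≤ b i := fun i hi => by rcases hb01 i hi with h | h <;> simp [h]
  have hb_le : ∀ i < K, b i ≤ 1 := fun i hi => by rcases hb01 i hi with h | h <;> simp [h]
  refine ⟨fun l => -b l, mem_DK_of_abs_le b hb_le (fun k hk =>
    hbw _ _ _ (by omega) hk (hwin k hk)) fun l => ?_, ?_⟩
  · rw [abs_neg, abs_of_nonneg (hb_nonneg l l.2)]
  · rw [soc_eq_sum hΔt hm h1, ysoc_eq_sum]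
    have hpad_nonneg : ∀ {x : Fin K → ℝ}, (∀ l, 0 ≤ x l) → ∀ i, 0 ≤ pad x i := by
      intro x hx i
      unfold pad
      split
      · exact hx _
      · exact le_rfl
    have hcell : ∀ i ∈ Finset.range K, Δt * (φ i 0 - (φ i 0 - φ i (-1)) * a i) ≤
        ∫ s in ((i : ℝ) * Δt)..(((i + 1 : ℕ) : ℝ) * Δt), φ i (δ s) := by
      intro i hi
      rw [Finset.mem_range] at hi
      have hlin := (hint i hi).const_mul (φ i 0 - φ i (-1))
      refine Eq.trans_le ?_ (intervalIntegral.integral_mono_on (cell_le hΔt i)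
        (intervalIntegrable_const.sub hlin)
        (intervalIntegrable_socRate_comp hΔt hi hm h1 _ _ _ _ _) fun s hs =>
          socRate_chord_le hηp hηm (hpad_nonneg hxb i) (hpad_nonneg hxr i) (hab i hi s hs))
      rw [intervalIntegral.integral_sub intervalIntegrable_const hlin,
        intervalIntegral.integral_const_mul]
      simp only [intervalIntegral.integral_const, smul_eq_mul, ha, hφ]
      push_cast
      field_simp
      ring
    have hvert : ∀ i ∈ Finset.range K, Δt * φ i (pad (fun l : Fin K => -b l) i) =
        Δt * (φ i 0 - (φ i 0 - φ i (-1)) * b i) := by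
      intro i hi
      rw [Finset.mem_range] at hi
      simp only [pad, hi, dif_pos]
      rcases hb01 i hi with h | h <;> simp [h]
    have hsum := Finset.sum_le_sum hcell
    refine add_le_add_right ?_ y0
    rw [Finset.sum_congr rfl hvert]
    refine le_trans ?_ hsum
    rw [← Finset.mul_sum, ← Finset.mul_sum, Finset.sum_sub_distrib, Finset.sum_sub_distrib]
    gcongr

/-- Proposition 8: the worst-case terminal deviation penalty
over the continuous uncertainty set `D̂` and the initial-state interval `Ŷ₀`
equals its discrete counterpart. -/
theorem stmt_10 (Δt : ℝ) (K Wh gh : ℕ) (hΔt : 0 < Δt)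
    (hgh : 0 < gh) (hghWh : gh ≤ Wh) (hWhK : Wh ≤ K)
    (T Γh γh : ℝ) (hT : T = K * Δt) (hΓh : Γh = Wh * Δt) (hγh : γh = gh * Δt)
    (ηp ηm : ℝ) (hηp : ηp ∈ Ioc (0:ℝ) 1) (hηm : ηm ∈ Ioc (0:ℝ) 1)
    (xb xr d : Fin K → ℝ) (hxb : ∀ l, 0 ≤ xb l) (hxr : ∀ l, 0 ≤ xr l)
    (pstar ystar : ℝ) (hpstar : 0 ≤ pstar)
    (ylh yuh : ℝ) (hyh : ylh ≤ yuh) :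
    sSup {v : ℝ | ∃ δ ∈ Dset T Γh γh, ∃ y0 ∈ Icc ylh yuh,
        v = pstar * |soc ηp ηm (lift Δt xb) (lift Δt xr) δ (lift Δt d) y0 T - ystar|} =
      sSup {v : ℝ | ∃ δv ∈ DK K Wh gh, ∃ y0 ∈ Icc ylh yuh,
        v = pstar * |ysoc Δt ηp ηm xb xr δv d y0 K - ystar|} := by
  subst hT hΓh hγh
  refine csSup_eq_csSup_of_forall_exists_le ?_ ?_
  · rintro _ ⟨δ, hδ, y0, hy0, rfl⟩
    rcases le_total 0 (soc ηp ηm (lift Δt xb) (lift Δt xr) δ (lift Δt d) y0 (K * Δt) - ystar)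
      with hs | hs
    · obtain ⟨v, hv, hle⟩ := exists_soc_le_ysoc hΔt hδ hηp hηm xb xr d y0
      refine ⟨_, ⟨v, hv, y0, hy0, rfl⟩, mul_le_mul_of_nonneg_left ?_ hpstar⟩
      rw [abs_of_nonneg hs]
      exact (sub_le_sub_right hle _).trans (le_abs_self _)
    · obtain ⟨v, hv, hle⟩ := exists_ysoc_le_soc hΔt hδ hηp hηm hxb hxr d y0
      refine ⟨_, ⟨v, hv, y0, hy0, rfl⟩, mul_le_mul_of_nonneg_left ?_ hpstar⟩
      rw [abs_of_nonpos hs]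
      exact (neg_le_neg (sub_le_sub_right hle _)).trans (neg_le_abs _)
  · rintro _ ⟨v, hv, y0, hy0, rfl⟩
    refine ⟨_, ⟨lift Δt v, lift_mem_Dset hΔt hv, y0, hy0, rfl⟩, ?_⟩
    rw [soc_lift_eq_ysoc hΔt hv.1]
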